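/- arXiv:math/9804106 — 4 statements merged into one kernel-verified Lean document; each statement's English description precedes it below -/
import Mathlib

section
/- Let R be a commutative ring. Every natural transformation θ between the trifunctors (A,B,C) ↦ A ⊗[R] (B ⊗[R] C) and (A,B,C) ↦ (A ⊗[R] B) ⊗[R] C on R-modules — i.e., every family of R-linear maps θ_{A,B,C} : A ⊗ (B ⊗ C) → (A ⊗ B) ⊗ C satisfying θ_{A′,B′,C′} ∘ (f ⊗ (g ⊗ h)) = ((f ⊗ g) ⊗ h) ∘ θ_{A,B,C} for all R-linear maps f, g, h — is of the form θ_{A,B,C} = r • α⁻¹ for a unique element r ∈ R; moreover θ_{A,B,C} is bijective for all A, B, C if and only if r is a unit of R. Hence the natural reassociation isomorphisms on R-modules are classified by the group of units Rˣ. -/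
open TensorProduct

/-- **Classification of natural reassociations on `R`-modules.**
Every natural transformation `θ` between the trifunctors `(A,B,C) ↦ A ⊗ (B ⊗ C)` and
`(A,B,C) ↦ (A ⊗ B) ⊗ C` on `R`-modules is of the form `θ = r • α⁻¹` for a unique `r ∈ R`
(where `α` is the standard associativity isomorphism), and `θ` is everywhere bijective
iff `r` is a unit of `R`.  Hence the natural reassociation isomorphisms on `R`-modules
are classified by the group of units `Rˣ`. -/
theorem natural_reassociation_classification (R : Type u) [CommRing R]
    (θ : ∀ (A B C : Type u) [AddCommGroup A] [AddCommGroup B] [AddCommGroup C]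
      [Module R A] [Module R B] [Module R C],
      (A ⊗[R] (B ⊗[R] C)) →ₗ[R] ((A ⊗[R] B) ⊗[R] C))
    (hθ : ∀ (A B C A' B' C' : Type u)
      [AddCommGroup A] [AddCommGroup B] [AddCommGroup C]
      [AddCommGroup A'] [AddCommGroup B'] [AddCommGroup C']
      [Module R A] [Module R B] [Module R C] [Module R A'] [Module R B'] [Module R C']
      (f : A →ₗ[R] A') (g : B →ₗ[R] B') (h : C →ₗ[R] C'),
      (θ A' B' C').comp (TensorProduct.map f (TensorProduct.map g h)) =
        (TensorProduct.map (TensorProduct.map f g) h).comp (θ A B C)) :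
    ∃ r : R,
      (∀ (A B C : Type u) [AddCommGroup A] [AddCommGroup B] [AddCommGroup C]
          [Module R A] [Module R B] [Module R C],
        θ A B C = r • (TensorProduct.assoc R A B C).symm.toLinearMap) ∧
      (∀ r' : R,
        (∀ (A B C : Type u) [AddCommGroup A] [AddCommGroup B] [AddCommGroup C]
            [Module R A] [Module R B] [Module R C],
          θ A B C = r' • (TensorProduct.assoc R A B C).symm.toLinearMap) → r' = r) ∧
      ((∀ (A B C : Type u) [AddCommGroup A] [AddCommGroup B] [AddCommGroup C]
          [Module R A] [Module R B] [Module R C],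
        Function.Bijective (θ A B C)) ↔ IsUnit r) := by
  let E : ((R ⊗[R] R) ⊗[R] R) ≃ₗ[R] R :=
    (TensorProduct.congr (TensorProduct.lid R R) (LinearEquiv.refl R R)).trans
      (TensorProduct.lid R R)
  have hE : E ((1 ⊗ₜ[R] 1) ⊗ₜ[R] 1) = 1 := by simp [E]
  have key : ∀ (A B C : Type u) [AddCommGroup A] [AddCommGroup B] [AddCommGroup C]
      [Module R A] [Module R B] [Module R C],
      θ A B C = E (θ R R R (1 ⊗ₜ[R] (1 ⊗ₜ[R] 1))) •
        (TensorProduct.assoc R A B C).symm.toLinearMap := by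
    intro A B C _ _ _ _ _ _
    have h1 : θ R R R (1 ⊗ₜ[R] (1 ⊗ₜ[R] 1)) =
        E (θ R R R (1 ⊗ₜ[R] (1 ⊗ₜ[R] 1))) • ((1 ⊗ₜ[R] 1) ⊗ₜ[R] 1) := by
      apply E.injective
      rw [map_smul, hE, smul_eq_mul, mul_one]
    generalize E (θ R R R (1 ⊗ₜ[R] (1 ⊗ₜ[R] 1))) = r at h1
    have h2 : ∀ (a : A) (b : B) (c : C),
        θ A B C (a ⊗ₜ[R] (b ⊗ₜ[R] c)) = r • ((a ⊗ₜ[R] b) ⊗ₜ[R] c) := by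
      intro a b c
      have h := LinearMap.congr_fun (hθ R R R A B C (LinearMap.toSpanSingleton R A a)
        (LinearMap.toSpanSingleton R B b) (LinearMap.toSpanSingleton R C c))
        (1 ⊗ₜ[R] (1 ⊗ₜ[R] 1))
      rw [LinearMap.comp_apply, LinearMap.comp_apply, h1, map_smul] at h
      simpa only [TensorProduct.map_tmul, LinearMap.toSpanSingleton_apply, one_smul] using h
    apply LinearMap.ext
    intro x
    induction x using TensorProduct.induction_on with
    | zero => rw [map_zero, map_zero]
    | add x y hx hy => rw [map_add, map_add, hx, hy]
    | tmul a y =>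
      induction y using TensorProduct.induction_on with
      | zero => rw [TensorProduct.tmul_zero, map_zero, map_zero]
      | add x y hx hy => rw [TensorProduct.tmul_add, map_add, map_add, hx, hy]
      | tmul b c =>
        rw [h2]
        simp
  refine ⟨E (θ R R R (1 ⊗ₜ[R] (1 ⊗ₜ[R] 1))), key, ?_, ?_, ?_⟩
  · intro r' hr'
    rw [hr' R R R, LinearMap.smul_apply, LinearEquiv.coe_coe, TensorProduct.assoc_symm_tmul,
      map_smul, hE, smul_eq_mul, mul_one]
  · intro hb
    obtain ⟨x, hx⟩ := (hb R R R).2 ((1 ⊗ₜ[R] 1) ⊗ₜ[R] 1)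
    have hk := key R R R
    generalize E (θ R R R (1 ⊗ₜ[R] (1 ⊗ₜ[R] 1))) = r at hk ⊢
    rw [hk, LinearMap.smul_apply] at hx
    have := congrArg E hx
    rw [map_smul, hE, smul_eq_mul] at this
    exact IsUnit.of_mul_eq_one _ this
  · intro hu A B C _ _ _ _ _ _
    have hk := key A B C
    generalize E (θ R R R (1 ⊗ₜ[R] (1 ⊗ₜ[R] 1))) = r at hk hu
    obtain ⟨v, rfl⟩ := hu
    rw [hk]
    exact ((TensorProduct.assoc R A B C).symm.trans
      (LinearEquiv.smulOfUnit (R := R) v)).bijective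
end

section
/- For any type X, the multiplicative congruence on the free magma FreeMagma X generated by the restricted relations a·(x·c) ∼ (a·x)·c, where x ranges over the generators (elements of X, viewed in FreeMagma X) and a, c range over all of FreeMagma X, is equal to the multiplicative congruence generated by all associativity relations a·(b·c) ∼ (a·b)·c with a, b, c ∈ FreeMagma X. That is, parentheses can always be moved one letter at a time: reassociation moves whose middle factor is a single letter already generate all reassociations. -/
/-- Parentheses can always be moved one letter at a time: the multiplicative congruence on
the free magma `FreeMagma X` generated by the restricted reassociations
`a·(x·c) ∼ (a·x)·c`, with middle factor a single generator `x : X`, is equal to the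
multiplicative congruence generated by all associativity relations `a·(b·c) ∼ (a·b)·c`. -/
theorem conGen_singleLetter_assoc_eq (X : Type u) :
    conGen (fun s t : FreeMagma X =>
        ∃ (a c : FreeMagma X) (x : X),
          s = a * (FreeMagma.of x * c) ∧ t = (a * FreeMagma.of x) * c) =
      conGen (fun s t : FreeMagma X =>
        ∃ a b c : FreeMagma X, s = a * (b * c) ∧ t = (a * b) * c) := by
  apply le_antisymm
  · apply Con.conGen_mono
    rintro s t ⟨a, c, x, hs, ht⟩
    exact ⟨a, FreeMagma.of x, c, hs, ht⟩
  · rw [Con.conGen_le]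
    rintro s t ⟨a, b, c, rfl, rfl⟩
    change ConGen.Rel _ _ _
    induction b using FreeMagma.recOnMul generalizing a c with
    | ih1 x => exact ConGen.Rel.of _ _ ⟨a, c, x, rfl, rfl⟩
    | ih2 p q hp hq =>
      exact ((ConGen.Rel.refl a).mul (hq p c).symm).trans
        ((hp a (q * c)).trans ((hq (a * p) c).trans
          ((hp a q).symm.mul (ConGen.Rel.refl c))))
end

section
/- Let α be a type and let a, b, t be three pairwise distinct elements of α. The group presented by the generators α subject to the single relation t·a·t⁻¹ = b (i.e., the quotient of the free group on α by the normal closure of the single relator t·a·t⁻¹·b⁻¹) is a free group; indeed it is isomorphic to the free group on the subtype {x : α // x ≠ b}. (This Tietze transformation underlies the computation that π(A₆), whose presentation has one HNN-type relation ⟨1,4,1⟩·ρλ⟨1,2,1⟩·⟨1,4,1⟩⁻¹ = λρ⟨1,2,1⟩, is a free group on 15 generators.) -/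
/-- **A Tietze transformation.**  For three pairwise distinct elements `a`, `b`, `t` of `α`,
the group presented by the generators `α` subject to the single relation `t·a·t⁻¹ = b`
(quotient of the free group on `α` by the normal closure of the relator `t·a·t⁻¹·b⁻¹`)
is a free group: it is isomorphic to the free group on `{x : α // x ≠ b}`.  (This underlies
the computation that `π(A₆)`, presented with one HNN-type relation, is free on 15
generators.) -/
theorem presentedGroup_single_conjugation_relator_free (α : Type u) (a b t : α)
    (hab : a ≠ b) (hat : a ≠ t) (hbt : b ≠ t) :
    Nonempty
      (PresentedGroup
          ({FreeGroup.of t * FreeGroup.of a * (FreeGroup.of t)⁻¹ * (FreeGroup.of b)⁻¹} :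
            Set (FreeGroup α)) ≃*
        FreeGroup {x : α // x ≠ b}) := by
  classical
  let f : α → FreeGroup {x : α // x ≠ b} := fun x =>
    if h : x = b then
      FreeGroup.of ⟨t, hbt.symm⟩ * FreeGroup.of ⟨a, hab⟩ * (FreeGroup.of ⟨t, hbt.symm⟩)⁻¹
    else FreeGroup.of ⟨x, h⟩
  have fb : f b = FreeGroup.of ⟨t, hbt.symm⟩ * FreeGroup.of ⟨a, hab⟩ *
      (FreeGroup.of ⟨t, hbt.symm⟩)⁻¹ := dif_pos rfl
  have fn : ∀ x (h : x ≠ b), f x = FreeGroup.of ⟨x, h⟩ := fun x h => dif_neg h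
  have hf : ∀ r ∈ ({FreeGroup.of t * FreeGroup.of a * (FreeGroup.of t)⁻¹ *
      (FreeGroup.of b)⁻¹} : Set (FreeGroup α)), FreeGroup.lift f r = 1 := by
    intro r hr
    rw [Set.mem_singleton_iff] at hr
    subst hr
    simp only [map_mul, map_inv, FreeGroup.lift_apply_of, fb, fn t hbt.symm, fn a hab]
    group
  let g : FreeGroup {x : α // x ≠ b} →* PresentedGroup
      ({FreeGroup.of t * FreeGroup.of a * (FreeGroup.of t)⁻¹ * (FreeGroup.of b)⁻¹} :
        Set (FreeGroup α)) := FreeGroup.lift fun x => PresentedGroup.of x.1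
  have gof : ∀ x, g (FreeGroup.of x) = PresentedGroup.of x.1 := fun x =>
    FreeGroup.lift_apply_of
  refine ⟨MonoidHom.toMulEquiv (PresentedGroup.toGroup hf) g ?_ ?_⟩
  · apply PresentedGroup.ext
    intro x
    rw [MonoidHom.comp_apply, PresentedGroup.toGroup.of, MonoidHom.id_apply]
    by_cases h : x = b
    · subst h
      rw [fb, map_mul, map_mul, map_inv, gof, gof]
      exact PresentedGroup.mk_eq_mk_of_mul_inv_mem (Set.mem_singleton _)
    · rw [fn x h, gof]
  · apply FreeGroup.ext_hom
    intro x
    rw [MonoidHom.comp_apply, gof, PresentedGroup.toGroup.of, MonoidHom.id_apply, fn x.1 x.2]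
end

section
/- A free group contains no subgroup isomorphic to ℤ × ℤ: if G is a free group, then there is no injective group homomorphism from ℤ × ℤ into G. In particular, ℤ × ℤ is not a free group. -/
theorem zsq_not_freeGroup (T : Type w) (e : Multiplicative (ℤ × ℤ) ≃* FreeGroup T) : False := by
  classical
  have hcomm : ∀ x y : FreeGroup T, x * y = y * x := by
    intro x y
    apply e.symm.injective
    rw [map_mul, map_mul, mul_comm]
  have hsub : ∀ a b : T, a = b := by
    intro a b
    by_contra hab
    have h := congrArg (FreeGroup.lift (fun x : T => if x = a then
      (Equiv.swap 0 1 : Equiv.Perm (Fin 3)) else Equiv.swap 1 2))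
      (hcomm (FreeGroup.of a) (FreeGroup.of b))
    simp only [map_mul, FreeGroup.lift_apply_of, if_true, if_neg (Ne.symm hab)] at h
    revert h
    decide
  have hcyc : ∃ g : FreeGroup T, ∀ x : FreeGroup T, x ∈ Subgroup.zpowers g := by
    rcases isEmpty_or_nonempty T with hT | ⟨⟨a⟩⟩
    · refine ⟨1, fun x => ?_⟩
      rw [Subsingleton.elim x 1]
      exact one_mem _
    · refine ⟨FreeGroup.of a, fun x => ?_⟩
      induction x using FreeGroup.induction_on with
      | C1 => exact one_mem _
      | of x => rw [hsub x a]; exact Subgroup.mem_zpowers _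
      | inv_of x h => exact inv_mem h
      | mul x y hx hy => exact mul_mem hx hy
  obtain ⟨g, hg⟩ := hcyc
  have key : ∀ z : ℤ × ℤ, ∃ n : ℤ, n • (Multiplicative.toAdd (e.symm g)) = z := by
    intro z
    obtain ⟨n, hn⟩ := Subgroup.mem_zpowers_iff.1 (hg (e (Multiplicative.ofAdd z)))
    refine ⟨n, ?_⟩
    rw [← toAdd_zpow, ← map_zpow, hn]
    simp
  generalize Multiplicative.toAdd (e.symm g) = p at key
  obtain ⟨n, hn⟩ := key (1, 0)
  obtain ⟨m, hm⟩ := key (0, 1)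
  have h1 : n * p.1 = 1 := by simpa using congrArg Prod.fst hn
  have h2 : n * p.2 = 0 := by simpa using congrArg Prod.snd hn
  have h3 : m * p.2 = 1 := by simpa using congrArg Prod.snd hm
  rcases mul_eq_zero.1 h2 with h | h <;> simp [h] at h1 h3

/-- **A free group contains no copy of ℤ × ℤ.**  If `G` is a free group (i.e. `G` is
isomorphic to the free group on some type `S`), then there is no injective group
homomorphism from `ℤ × ℤ` into `G`; in particular, `ℤ × ℤ` is not a free group. -/
theorem free_group_no_zsq_subgroup (G : Type u) [Group G] (S : Type v)
    (e : G ≃* FreeGroup S) :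
    (¬ ∃ f : Multiplicative (ℤ × ℤ) →* G, Function.Injective f) ∧
    ∀ T : Type w, IsEmpty (Multiplicative (ℤ × ℤ) ≃* FreeGroup T) := by
  refine ⟨?_, fun T => ⟨fun e' => zsq_not_freeGroup T e'⟩⟩
  rintro ⟨f, hf⟩
  let F : Multiplicative (ℤ × ℤ) →* FreeGroup S := e.toMonoidHom.comp f
  have hF : Function.Injective F := e.injective.comp hf
  exact zsq_not_freeGroup _ ((MonoidHom.ofInjective hF).trans
    (IsFreeGroup.toFreeGroup F.range))
end
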